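/- For every r ≥ 3 there exists an uncountable set of r-tuples α = (α₁,…,α_r) ∈ ℝ^r, each with 1, α₁, …, α_r linearly independent over ℚ, such that for each such α there exists ν₀ with Δ^r_ν = 0 for all ν > ν₀, i.e., the determinant of any r+1 consecutive best approximations (in the sense of linear form) eventually vanishes. -/

import Mathlib

open scoped BigOperators

/-- `ζ(m) = |m₀ + m₁α₁ + … + m_rα_r|` : value of the linear form at the integer point `m`. -/
noncomputable def zetaLF {r : ℕ} (α : Fin r → ℝ) (m : Fin (r + 1) → ℤ) : ℝ :=
  |(m 0 : ℝ) + ∑ j : Fin r, (m j.succ : ℝ) * α j|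

/-- `M(m) = max_j |m_j|`. -/
def heightLF {r : ℕ} (m : Fin (r + 1) → ℤ) : ℕ :=
  Finset.univ.sup fun j => (m j).natAbs

/-- `m ≠ 0` is a best approximation in the sense of linear form:
`ζ(m) = min {ζ(n) : n ≠ 0, M(n) ≤ M(m)}`. -/
def IsBestApproxLF {r : ℕ} (α : Fin r → ℝ) (m : Fin (r + 1) → ℤ) : Prop :=
  m ≠ 0 ∧ ∀ n : Fin (r + 1) → ℤ, n ≠ 0 → heightLF n ≤ heightLF m →
    zetaLF α m ≤ zetaLF α n

/-- `m : ℕ → ℤ^{r+1}` enumerates the best approximations to the linear form given by `α`,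
ordered by strictly increasing height, and exhaustively (every best approximation occurs
at one of the heights `M_ν`). -/
def IsBestApproxSeqLF {r : ℕ} (α : Fin r → ℝ) (m : ℕ → Fin (r + 1) → ℤ) : Prop :=
  (∀ ν : ℕ, IsBestApproxLF α (m ν)) ∧
  (∀ ν : ℕ, heightLF (m ν) < heightLF (m (ν + 1))) ∧
  (∀ n : Fin (r + 1) → ℤ, IsBestApproxLF α n → ∃ ν : ℕ, heightLF (m ν) = heightLF n)

/-- `1, α₁, …, α_r` are linearly independent over `ℚ`. -/
def QIndepLF {r : ℕ} (α : Fin r → ℝ) : Prop :=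
  ∀ c : Fin (r + 1) → ℤ, ((c 0 : ℝ) + ∑ j : Fin r, (c j.succ : ℝ) * α j = 0) → c = 0

/-- The linear form `m₀ + m₁α₁ + … + m_rα_r`, without absolute value. -/
noncomputable def formLF {r : ℕ} (α : Fin r → ℝ) (m : Fin (r + 1) → ℤ) : ℝ :=
  (m 0 : ℝ) + ∑ j : Fin r, (m j.succ : ℝ) * α j

lemma formLF_snoc {k : ℕ} (a : Fin k → ℝ) (x : ℝ) (m : Fin (k + 1 + 1) → ℤ) :
    formLF (Fin.snoc a x : Fin (k + 1) → ℝ) m =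
      formLF a (fun i => m i.castSucc) + m (Fin.last (k + 1)) * x := by
  simp only [formLF, Fin.sum_univ_castSucc, Fin.snoc_castSucc, Fin.snoc_last, Fin.succ_castSucc,
    Fin.succ_last, Fin.castSucc_zero, add_assoc]

lemma heightLF_le_iff {r : ℕ} {m : Fin (r + 1) → ℤ} {T : ℕ} :
    heightLF m ≤ T ↔ ∀ j, (m j).natAbs ≤ T := by
  simp [heightLF, Finset.sup_le_iff]

lemma finite_heightLF_le (r T : ℕ) : {m : Fin (r + 1) → ℤ | heightLF m ≤ T}.Finite := by
  refine (Set.finite_Icc (fun _ => -(T : ℤ)) (fun _ => (T : ℤ))).subset fun m hm => ?_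
  have h := heightLF_le_iff.1 hm
  exact ⟨fun j => by have := h j; simp only; omega, fun j => by have := h j; simp only; omega⟩

/-- For every `T ≥ 4`, some nonzero integer vector of height at most `T` makes the linear form of
`α` smaller than `ψ T`. -/
def IsUniformlySmallLF {r : ℕ} (ψ : ℕ → ℝ) (α : Fin r → ℝ) : Prop :=
  ∀ T : ℕ, 4 ≤ T → ∃ m : Fin (r + 1) → ℤ, m ≠ 0 ∧ heightLF m ≤ T ∧ zetaLF α m < ψ T

lemma IsUniformlySmallLF.snoc {k : ℕ} {ψ : ℕ → ℝ} {a : Fin k → ℝ}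
    (ha : IsUniformlySmallLF ψ a) (x : ℝ) :
    IsUniformlySmallLF ψ (Fin.snoc a x : Fin (k + 1) → ℝ) := by
  intro T hT
  obtain ⟨m, hm0, hmT, hm⟩ := ha T hT
  refine ⟨Fin.snoc m 0, ?_, ?_, ?_⟩
  · intro h
    apply hm0
    funext i
    simpa using congrFun h i.castSucc
  · rw [heightLF_le_iff] at hmT ⊢
    intro j
    refine Fin.lastCases ?_ (fun i => ?_) j
    · simp
    · simpa using hmT i
  · change |formLF _ _| < _
    rw [formLF_snoc]
    change |formLF _ _| < _ at hm
    simpa only [Fin.snoc_castSucc, Fin.snoc_last, Int.cast_zero, zero_mul, add_zero] using hm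

/-- All but countably many `x` extend a `ℚ`-independent tuple to a `ℚ`-independent tuple. -/
lemma QIndepLF.countable_not_snoc {k : ℕ} {a : Fin k → ℝ} (ha : QIndepLF a) :
    {x : ℝ | ¬ QIndepLF (Fin.snoc a x : Fin (k + 1) → ℝ)}.Countable := by
  refine (Set.countable_range fun c : Fin (k + 1 + 1) → ℤ =>
    -formLF a (fun i => c i.castSucc) / (c (Fin.last (k + 1)) : ℝ)).mono ?_
  intro x hx
  simp only [Set.mem_ofPred_eq, QIndepLF, not_forall] at hx
  obtain ⟨c, hc, hc0⟩ := hx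
  change formLF _ _ = 0 at hc
  rw [formLF_snoc] at hc
  refine ⟨c, ?_⟩
  by_cases hl : c (Fin.last (k + 1)) = 0
  · refine absurd ?_ hc0
    have h0 := ha (fun i => c i.castSucc) (by simpa [hl, formLF] using hc)
    funext j
    refine Fin.lastCases hl (fun i => congrFun h0 i) j
  · have : (c (Fin.last (k + 1)) : ℝ) ≠ 0 := by exact_mod_cast hl
    simp only
    field_simp
    linarith

/-- For any prescribed `ψ` there is a divisibility chain growing fast with respect to `ψ`. -/
lemma exists_divisibility_chain (ψ : ℕ → ℝ) :
    ∃ Q : ℕ → ℕ, Q 0 = 4 ∧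
      ∀ n, ∃ K : ℕ, Q (n + 1) = Q n * K ∧ Q n ≤ K ∧ 2 / ψ (Q n) < K := by
  let f : ℕ → ℕ := fun q => q * (q + (⌈2 / ψ q⌉₊ + 1))
  refine ⟨fun n => Nat.rec 4 (fun _ q => f q) n, rfl, fun n => ⟨_, rfl, Nat.le_add_right _ _, ?_⟩⟩
  push_cast
  have := Nat.le_ceil (2 / ψ (Nat.rec 4 (fun _ q => f q) n))
  have h2 : (0 : ℝ) ≤ ((Nat.rec 4 (fun _ q => f q) n : ℕ) : ℝ) := Nat.cast_nonneg _
  linarith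

section Chain

variable {Q : ℕ → ℕ}

lemma abs_div_chain_le (h0 : ∀ n, 0 < Q n) (h2 : ∀ n, 2 * Q n ≤ Q (n + 1)) {e : ℕ → ℝ} {C : ℝ}
    (he : ∀ j, |e j| ≤ C) (n i : ℕ) : |e (n + i) / Q (n + i)| ≤ C / Q n * (1 / 2) ^ i := by
  have hC : 0 ≤ C := (abs_nonneg _).trans (he 0)
  have hQ : ∀ i, (Q n : ℝ) * 2 ^ i ≤ Q (n + i) := by
    intro i
    induction i with
    | zero => simp
    | succ i ih =>
      have : (2 * Q (n + i) : ℝ) ≤ Q (n + i + 1) := by exact_mod_cast h2 (n + i)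
      rw [← add_assoc, pow_succ]
      linarith
  have hn : (0 : ℝ) < Q n := by exact_mod_cast h0 n
  rw [abs_div, Nat.abs_cast]
  calc |e (n + i)| / Q (n + i) ≤ C / (Q n * 2 ^ i) := by
        gcongr
        · exact he _
        · exact hQ i
    _ = C / Q n * (1 / 2) ^ i := by
        rw [one_div, inv_pow]
        field_simp

lemma summable_div_chain (h0 : ∀ n, 0 < Q n) (h2 : ∀ n, 2 * Q n ≤ Q (n + 1)) {e : ℕ → ℝ} {C : ℝ}
    (he : ∀ j, |e j| ≤ C) (n : ℕ) : Summable fun i => e (n + i) / (Q (n + i) : ℝ) :=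
  Summable.of_norm_bounded (g := fun i => C / Q n * (1 / 2) ^ i) (summable_geometric_two.mul_left _)
    (fun i => (Real.norm_eq_abs _).trans_le (abs_div_chain_le h0 h2 he n i))

lemma abs_tsum_div_chain_le (h0 : ∀ n, 0 < Q n) (h2 : ∀ n, 2 * Q n ≤ Q (n + 1)) {e : ℕ → ℝ}
    {C : ℝ} (he : ∀ j, |e j| ≤ C) (n : ℕ) :
    |∑' i, e (n + i) / (Q (n + i) : ℝ)| ≤ 2 * C / Q n := by
  have h := tsum_of_norm_bounded (f := fun i => e (n + i) / (Q (n + i) : ℝ)) (hasSum_geometric_two.mul_left (C / (Q n : ℝ)))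
    (fun i => (Real.norm_eq_abs _).trans_le (abs_div_chain_le h0 h2 he n i))
  rw [Real.norm_eq_abs] at h
  linarith [show 2 * C / (Q n : ℝ) = C / Q n * 2 by ring]

lemma tsum_div_chain_succ (h0 : ∀ n, 0 < Q n) (h2 : ∀ n, 2 * Q n ≤ Q (n + 1)) {e : ℕ → ℝ}
    {C : ℝ} (he : ∀ j, |e j| ≤ C) (n : ℕ) :
    ∑' i, e (n + i) / (Q (n + i) : ℝ) =
      e n / Q n + ∑' i, e (n + 1 + i) / (Q (n + 1 + i) : ℝ) := by
  rw [(summable_div_chain h0 h2 he n).tsum_eq_zero_add]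
  simp [add_assoc, add_comm 1]

/-- Multiplying an integral series along a divisibility chain by `Q n` leaves an integer plus
a tail. -/
lemma exists_int_add_tail (h0 : ∀ n, 0 < Q n) (h2 : ∀ n, 2 * Q n ≤ Q (n + 1))
    (hd : ∀ n, Q n ∣ Q (n + 1)) {e : ℕ → ℤ} {C : ℝ} (he : ∀ j, |(e j : ℝ)| ≤ C) (n : ℕ) :
    ∃ z : ℤ, (Q n : ℝ) * ∑' i, (e i : ℝ) / (Q i : ℝ) =
      z + Q n * ∑' i, (e (n + 1 + i) : ℝ) / (Q (n + 1 + i) : ℝ) := by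
  have hQ : ∀ n, (Q n : ℝ) ≠ 0 := fun n => by exact_mod_cast (h0 n).ne'
  have hs := tsum_div_chain_succ h0 h2 he
  induction n with
  | zero =>
    refine ⟨e 0, ?_⟩
    have := hs 0
    simp only [zero_add] at this ⊢
    rw [this, mul_add, mul_div_cancel₀ _ (hQ 0)]
  | succ n ih =>
    obtain ⟨z, hz⟩ := ih
    obtain ⟨K, hK⟩ := hd n
    have hK' : (Q (n + 1) : ℝ) = Q n * K := by exact_mod_cast hK
    refine ⟨K * z + e (n + 1), ?_⟩
    rw [hs (n + 1)] at hz
    have h3 : (Q (n + 1) : ℝ) * (e (n + 1) / Q (n + 1)) = e (n + 1) := mul_div_cancel₀ _ (hQ _)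
    push_cast
    calc (Q (n + 1) : ℝ) * ∑' i, (e i : ℝ) / (Q i : ℝ)
        = K * (Q n * ∑' i, (e i : ℝ) / (Q i : ℝ)) := by rw [hK']; ring
      _ = K * z + (Q n * K) * (e (n + 1) / Q (n + 1))
          + (Q n * K) * ∑' i, (e (n + 1 + 1 + i) : ℝ) / (Q (n + 1 + 1 + i) : ℝ) := by
            rw [hz]; ring
      _ = _ := by rw [← hK', h3]

/-- An integral series with bounded numerators along a chain with `Q (n + 1) ≥ (Q n) ^ 2` is an
integer only if its numerators eventually vanish. -/
lemma eventually_numerator_eq_zero (h4 : ∀ n, 4 ≤ Q n) (hsq : ∀ n, Q n * Q n ≤ Q (n + 1))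
    (hd : ∀ n, Q n ∣ Q (n + 1)) {e : ℕ → ℤ} {C : ℝ} (he : ∀ j, |(e j : ℝ)| ≤ C) (c : ℤ)
    (hc : (c : ℝ) + ∑' i, (e i : ℝ) / (Q i : ℝ) = 0) : ∃ N, ∀ n, N ≤ n → e n = 0 := by
  have h0 : ∀ n, 0 < Q n := fun n => by have := h4 n; omega
  have h2 : ∀ n, 2 * Q n ≤ Q (n + 1) := fun n => by nlinarith [h4 n, hsq n]
  have hQ0 : ∀ n, (0 : ℝ) < Q n := fun n => by exact_mod_cast h0 n
  have hmono : StrictMono Q := strictMono_nat_of_lt_succ fun n => by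
    have := h2 n; have := h0 n; omega
  obtain ⟨N, hN⟩ := exists_nat_gt (2 * C)
  have htail : ∀ n, N ≤ n → ∑' i, (e (n + 1 + i) : ℝ) / (Q (n + 1 + i) : ℝ) = 0 := by
    intro n hn
    obtain ⟨z, hz⟩ := exists_int_add_tail h0 h2 hd he n
    have hb := abs_tsum_div_chain_le h0 h2 he (n + 1)
    set t := ∑' i, (e (n + 1 + i) : ℝ) / (Q (n + 1 + i) : ℝ) with ht
    have hlt : |(Q n : ℝ) * t| < 1 := by
      rw [abs_mul, Nat.abs_cast]
      have hq : (Q n : ℝ) * Q n ≤ Q (n + 1) := by exact_mod_cast hsq n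
      have hNQ : (N : ℝ) ≤ Q n := by exact_mod_cast hn.trans (hmono.id_le n)
      calc (Q n : ℝ) * |t| ≤ Q n * (2 * C / Q (n + 1)) := by gcongr
        _ < 1 := by
          rw [← mul_div_assoc, div_lt_one (hQ0 _)]
          nlinarith [hQ0 n]
    have hint : (Q n : ℝ) * t = ((-(Q n * c) - z : ℤ) : ℝ) := by
      push_cast
      have : ∑' i, (e i : ℝ) / (Q i : ℝ) = -c := by linarith
      rw [this] at hz
      linarith
    rw [hint] at hlt
    have h3 : (-(Q n * c) - z : ℤ) = 0 := Int.abs_lt_one_iff.1 (by exact_mod_cast hlt)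
    rw [h3, Int.cast_zero] at hint
    exact (mul_eq_zero.1 hint).resolve_left (hQ0 n).ne'
  refine ⟨N + 1, fun n hn => ?_⟩
  obtain ⟨k, rfl⟩ : ∃ k, n = k + 1 := ⟨n - 1, by omega⟩
  have h := tsum_div_chain_succ h0 h2 he (k + 1)
  rw [htail k (by omega), htail (k + 1) (by omega), add_zero] at h
  have := (div_eq_zero_iff.1 h.symm).resolve_right (hQ0 _).ne'
  exact_mod_cast this

end Chain

/-- Khintchine: there are independent pairs whose linear form is uniformly as small as desired. -/
lemma exists_pair_isUniformlySmallLF {ψ : ℕ → ℝ} (hψ : ∀ T, 0 < ψ T) (hanti : Antitone ψ) :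
    ∃ a : Fin 2 → ℝ, QIndepLF a ∧ IsUniformlySmallLF ψ a := by
  obtain ⟨Q, hQ4, hstep⟩ := exists_divisibility_chain ψ
  have h4 : ∀ n, 4 ≤ Q n := by
    intro n
    induction n with
    | zero => exact hQ4.ge
    | succ n ih =>
      obtain ⟨K, h, hK, -⟩ := hstep n
      rw [h]; nlinarith
  have hsq : ∀ n, Q n * Q n ≤ Q (n + 1) := fun n => by
    obtain ⟨K, h, hK, -⟩ := hstep n
    rw [h]; gcongr
  have hd : ∀ n, Q n ∣ Q (n + 1) := fun n => by
    obtain ⟨K, h, -⟩ := hstep n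
    exact ⟨K, h⟩
  have h0 : ∀ n, 0 < Q n := fun n => by have := h4 n; omega
  have h2 : ∀ n, 2 * Q n ≤ Q (n + 1) := fun n => by nlinarith [h4 n, hsq n]
  have hQ0 : ∀ n, (0 : ℝ) < Q n := fun n => by exact_mod_cast h0 n
  have hmono : StrictMono Q := strictMono_nat_of_lt_succ fun n => by
    have := h2 n; have := h0 n; omega
  let e : ℕ → ℕ → ℤ := fun p j => if j % 2 = p then 1 else 0
  have he : ∀ p j, |(e p j : ℝ)| ≤ 1 := fun p j => by
    simp only [e]; split_ifs <;> simp
  let s : ℕ → ℝ := fun p => ∑' j, (e p j : ℝ) / (Q j : ℝ)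
  have hsum : ∀ p, Summable fun j => (e p j : ℝ) / (Q j : ℝ) := fun p => by
    simpa using summable_div_chain h0 h2 (he p) 0
  refine ⟨fun i => s i, ?_, ?_⟩
  · intro c hc
    simp only [Fin.sum_univ_two, Fin.val_zero, Fin.val_one] at hc
    let f : ℕ → ℤ := fun j => c 1 * e 0 j + c 2 * e 1 j
    have hf : ∀ j, |(f j : ℝ)| ≤ |(c 1 : ℝ)| + |(c 2 : ℝ)| := fun j => by
      simp only [f, Int.cast_add, Int.cast_mul]
      refine (abs_add_le _ _).trans ?_
      rw [abs_mul, abs_mul]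
      exact add_le_add (mul_le_of_le_one_right (abs_nonneg _) (he 0 j))
        (mul_le_of_le_one_right (abs_nonneg _) (he 1 j))
    have hfs : ∑' j, (f j : ℝ) / (Q j : ℝ) = c 1 * s 0 + c 2 * s 1 := by
      simp only [s]
      rw [← tsum_mul_left, ← tsum_mul_left,
        ← ((hsum 0).mul_left _).tsum_add ((hsum 1).mul_left _)]
      refine tsum_congr fun j => ?_
      simp only [f, Int.cast_add, Int.cast_mul]
      ring
    obtain ⟨N, hN⟩ := eventually_numerator_eq_zero h4 hsq hd hf (c 0) (by
      rw [hfs]; exact hc)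
    have h1 : c 1 = 0 := by
      have := hN (2 * N) (by omega)
      simpa [f, e] using this
    have h2' : c 2 = 0 := by
      have := hN (2 * N + 1) (by omega)
      simpa [f, e, Nat.add_mod] using this
    have h3 : c 0 = 0 := by
      have hc' : (c 0 : ℝ) + (c 1 * s 0 + c 2 * s 1) = 0 := hc
      simpa [h1, h2'] using hc'
    funext i
    fin_cases i
    exacts [h3, h1, h2']
  · intro T hT
    have hex : ∃ n, Q n ≤ T ∧ T < Q (n + 1) := by
      have hP : ∃ n, T < Q n := ⟨T + 1, hmono.id_le (T + 1)⟩
      obtain ⟨n, hn⟩ : ∃ n, Nat.find hP = n + 1 :=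
        Nat.exists_eq_succ_of_ne_zero fun h => by
          have hfind := Nat.find_spec hP
          rw [h] at hfind
          omega
      refine ⟨n, not_lt.1 (Nat.find_min hP (by omega)), hn ▸ Nat.find_spec hP⟩
    obtain ⟨n, hnT, hTn⟩ := hex
    let p : Fin 2 := ⟨n % 2, Nat.mod_lt _ two_pos⟩
    obtain ⟨z, hz⟩ := exists_int_add_tail h0 h2 hd (he p) n
    have hskip := tsum_div_chain_succ h0 h2 (he p) (n + 1)
    have hzero : e p (n + 1) = 0 := by
      simp only [e, p]; rw [if_neg]; omega
    rw [hskip, hzero, Int.cast_zero, zero_div, zero_add] at hz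
    have hb := abs_tsum_div_chain_le h0 h2 (he p) (n + 1 + 1)
    set t := ∑' i, (e p (n + 1 + 1 + i) : ℝ) / (Q (n + 1 + 1 + i) : ℝ) with ht
    have hs : |s p| ≤ 1 / 2 := by
      have := abs_tsum_div_chain_le h0 h2 (he p) 0
      simp only [zero_add] at this
      refine this.trans ?_
      rw [div_le_div_iff₀ (hQ0 0) two_pos]
      have : (4 : ℝ) ≤ Q 0 := by exact_mod_cast hQ4.ge
      linarith
    have ht2 : |t| ≤ 1 / 2 := by
      refine hb.trans ?_
      rw [div_le_div_iff₀ (hQ0 _) two_pos]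
      have : (4 : ℝ) ≤ Q (n + 1 + 1) := by exact_mod_cast h4 _
      linarith
    have hzQ : |(z : ℝ)| ≤ Q n := by
      have : (z : ℝ) = Q n * (s p - t) := by
        rw [mul_sub]; simp only [s]; linarith
      rw [this, abs_mul, Nat.abs_cast]
      refine mul_le_of_le_one_right (hQ0 n).le ?_
      have := abs_sub (s p) t
      linarith
    have hQt : |(Q n : ℝ) * t| < ψ T := by
      obtain ⟨K, hK, -, hKψ⟩ := hstep (n + 1)
      have hK' : (Q (n + 1 + 1) : ℝ) = Q (n + 1) * K := by exact_mod_cast hK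
      have hKpos : (0 : ℝ) < K := lt_trans (by have := hψ (Q (n + 1)); positivity) hKψ
      have hle : (Q n : ℝ) ≤ Q (n + 1) := by exact_mod_cast (hmono (Nat.lt_succ_self n)).le
      calc |(Q n : ℝ) * t| = Q n * |t| := by rw [abs_mul, Nat.abs_cast]
        _ ≤ Q (n + 1) * (2 * 1 / Q (n + 1 + 1)) := by gcongr
        _ = 2 / K := by
          rw [hK']
          have := hQ0 (n + 1)
          field_simp
        _ < ψ (Q (n + 1)) := by
          rw [div_lt_iff₀ hKpos]
          rwa [div_lt_iff₀ (hψ _), mul_comm] at hKψ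
        _ ≤ ψ T := hanti hTn.le
    refine ⟨Fin.cons (-z) (Pi.single p (Q n : ℤ)), ?_, ?_, ?_⟩
    · intro h
      have := congrFun h p.succ
      rw [Fin.cons_succ, Pi.single_eq_same, Pi.zero_apply] at this
      have := h0 n
      omega
    · rw [heightLF_le_iff]
      refine Fin.cases ?_ fun i => ?_
      · rw [Fin.cons_zero]
        have h6 : |z| ≤ Q n := by exact_mod_cast hzQ
        rw [Int.abs_eq_natAbs] at h6
        omega
      · rw [Fin.cons_succ, Pi.single_apply]
        split_ifs
        · simpa using hnT
        · simp
    · have : (∑ j : Fin 2, ((Pi.single p (Q n : ℤ) : Fin 2 → ℤ) j : ℝ) * s j) = Q n * s p := by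
        rw [Finset.sum_eq_single p]
        · simp
        · intro j _ hj
          simp [hj]
        · simp
      simp only [zetaLF, Fin.cons_zero, Fin.cons_succ, this]
      have h5 : ((-z : ℤ) : ℝ) + Q n * s p = Q n * t := by
        push_cast; simp only [s]; linarith
      rwa [h5]

lemma exists_isUniformlySmallLF {ψ : ℕ → ℝ} (hψ : ∀ T, 0 < ψ T) (hanti : Antitone ψ) {k : ℕ}
    (hk : 2 ≤ k) : ∃ a : Fin k → ℝ, QIndepLF a ∧ IsUniformlySmallLF ψ a := by
  induction k, hk using Nat.le_induction with
  | base => exact exists_pair_isUniformlySmallLF hψ hanti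
  | succ k _ ih =>
    obtain ⟨a, ha, hs⟩ := ih
    obtain ⟨x, hx⟩ : ∃ x : ℝ, QIndepLF (Fin.snoc a x : Fin (k + 1) → ℝ) := by
      by_contra! h
      have := ha.countable_not_snoc
      simp only [h, not_false_eq_true, Set.ofPred_true] at this
      exact Cardinal.not_countable_real this
    exact ⟨_, hx, hs.snoc x⟩

/-- Any positive weight on integer vectors dominates a positive antitone function of the height. -/
lemma exists_antitone_le_of_height {r : ℕ} {ε : (Fin (r + 1) → ℤ) → ℝ} (hε : ∀ m, 0 < ε m) :
    ∃ ψ : ℕ → ℝ, (∀ T, 0 < ψ T) ∧ Antitone ψ ∧ ∀ m, ψ (heightLF m) ≤ ε m := by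
  let F : ℕ → Finset (Fin (r + 1) → ℤ) := fun T => (finite_heightLF_le r T).toFinset
  have hF : ∀ T, (F T).Nonempty := fun T => ⟨0, by simp [F, heightLF]⟩
  refine ⟨fun T => (F T).inf' (hF T) ε, fun T => ?_, fun S T h => ?_, fun m => ?_⟩
  · exact (Finset.lt_inf'_iff _).2 fun m _ => hε m
  · refine Finset.inf'_mono _ (fun m hm => ?_) _
    simp only [F, Set.Finite.mem_toFinset, Set.mem_ofPred_eq] at hm ⊢
    exact hm.trans h
  · exact Finset.inf'_le _ (by simp [F])

/-- Borel–Cantelli: for almost every last coordinate, the linear form is rarely small at vectors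
whose last coordinate is nonzero. -/
lemma ae_finite_zetaLF_snoc_lt {k : ℕ} (a : Fin k → ℝ) {ε : (Fin (k + 1 + 1) → ℤ) → NNReal}
    (hε : ∑' m, (ε m : ENNReal) ≠ ⊤) :
    ∀ᵐ x : ℝ, {m : Fin (k + 1 + 1) → ℤ | m (Fin.last (k + 1)) ≠ 0 ∧
      zetaLF (Fin.snoc a x : Fin (k + 1) → ℝ) m < ε m}.Finite := by
  refine MeasureTheory.ae_finite_setOfPred_mem (s := fun m : Fin (k + 1 + 1) → ℤ =>
    {x : ℝ | m (Fin.last (k + 1)) ≠ 0 ∧ zetaLF (Fin.snoc a x : Fin (k + 1) → ℝ) m < ε m}) ?_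
  have h2 : ∑' m, (2 * ε m : ENNReal) ≠ ⊤ := by
    rw [ENNReal.tsum_mul_left]
    exact ENNReal.mul_ne_top (by simp) hε
  refine ne_top_of_le_ne_top h2 (ENNReal.tsum_le_tsum fun m => ?_)
  set q : ℤ := m (Fin.last (k + 1)) with hq
  set L := formLF a (fun i => m i.castSucc) with hL
  have hsub : {x : ℝ | q ≠ 0 ∧ zetaLF (Fin.snoc a x : Fin (k + 1) → ℝ) m < ε m} ⊆
      Metric.ball (-L / q) (ε m) := by
    rintro x ⟨hq0, hx⟩
    change |formLF _ _| < _ at hx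
    rw [formLF_snoc] at hx
    have hq1 : (1 : ℝ) ≤ |(q : ℝ)| := by exact_mod_cast Int.one_le_abs hq0
    have hqr : (q : ℝ) ≠ 0 := by exact_mod_cast hq0
    rw [Metric.mem_ball, Real.dist_eq]
    calc |x - -L / q| ≤ |(q : ℝ)| * |x - -L / q| := le_mul_of_one_le_left (abs_nonneg _) hq1
      _ = |L + q * x| := by
        rw [← abs_mul]
        congr 1
        field_simp
        ring
      _ < ε m := hx
  refine (MeasureTheory.measure_mono hsub).trans ?_
  rw [Real.volume_ball, ENNReal.ofReal_mul zero_le_two, ENNReal.ofReal_coe_nnreal]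
  simp

/-- For every `r ≥ 3` there is an uncountable set of `r`-tuples `α`,
each with `1, α₁, …, α_r` linearly independent over `ℚ`, for which the determinant
`Δ^r_ν` of any `r+1` consecutive best approximations eventually vanishes. -/
theorem stmt2 (r : ℕ) (hr : 3 ≤ r) :
    ∃ S : Set (Fin r → ℝ), ¬ S.Countable ∧
      ∀ α ∈ S, QIndepLF α ∧
        ∀ m : ℕ → Fin (r + 1) → ℤ, IsBestApproxSeqLF α m →
          ∃ ν₀ : ℕ, ∀ ν > ν₀,
            Matrix.det (Matrix.of fun i j : Fin (r + 1) => m (ν + (i : ℕ)) j) = 0 := by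
  obtain ⟨k, rfl⟩ : ∃ k, r = k + 1 := ⟨r - 1, by omega⟩
  obtain ⟨ε, hε0, hεs⟩ :=
    ENNReal.exists_pos_sum_of_countable (ε := 1) one_ne_zero (Fin (k + 1 + 1) → ℤ)
  obtain ⟨ψ, hψ0, hψa, hψε⟩ := exists_antitone_le_of_height (ε := fun m => (ε m : ℝ))
    fun m => by exact_mod_cast hε0 m
  obtain ⟨a, ha, has⟩ := exists_isUniformlySmallLF hψ0 hψa (k := k) (by omega)
  let G : Set ℝ := {x | QIndepLF (Fin.snoc a x : Fin (k + 1) → ℝ) ∧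
    {m : Fin (k + 1 + 1) → ℤ | m (Fin.last (k + 1)) ≠ 0 ∧
      zetaLF (Fin.snoc a x : Fin (k + 1) → ℝ) m < ε m}.Finite}
  have hG : ∀ᵐ x : ℝ, x ∈ G :=
    Filter.Eventually.and
      (by
        have h := ha.countable_not_snoc.measure_zero MeasureTheory.volume
        exact MeasureTheory.ae_iff.2 h)
      (ae_finite_zetaLF_snoc_lt a (hεs.trans ENNReal.one_lt_top).ne)
  refine ⟨(fun x => (Fin.snoc a x : Fin (k + 1) → ℝ)) '' G, fun hc => ?_, ?_⟩
  · have hinj : Function.Injective fun x : ℝ => (Fin.snoc a x : Fin (k + 1) → ℝ) := fun x y h => by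
      simpa using congrFun h (Fin.last k)
    have hGc : G.Countable := Set.countable_of_injective_of_countable_image hinj.injOn hc
    have h1 : ∀ᵐ x : ℝ, x ∉ G := hGc.ae_notMem _
    obtain ⟨x, hx, hx'⟩ := (hG.and h1).exists
    exact hx' hx
  · rintro _ ⟨x, ⟨hind, hfin⟩, rfl⟩
    refine ⟨hind, fun m hm => ?_⟩
    obtain ⟨B, hB⟩ := (hfin.image heightLF).bddAbove
    have hheight : ∀ ν, ν ≤ heightLF (m ν) :=
      (strictMono_nat_of_lt_succ (f := fun ν => heightLF (m ν)) hm.2.1).id_le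
    have hlast : ∀ ν, B + 4 < ν → m ν (Fin.last (k + 1)) = 0 := by
      intro ν hν
      by_contra hne
      have hνh := hheight ν
      obtain ⟨n, hn0, hnT, hnζ⟩ := has.snoc x (heightLF (m ν)) (by omega)
      have hlt := (((hm.1 ν).2 n hn0 hnT).trans_lt hnζ).trans_le (hψε (m ν))
      have := hB ⟨m ν, ⟨hne, hlt⟩, rfl⟩
      omega
    refine ⟨B + 4, fun ν hν => Matrix.det_eq_zero_of_column_eq_zero (Fin.last (k + 1)) fun i => ?_⟩
    exact hlast _ (by omega)
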